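/- arXiv:2405.16536 — 2 statements merged into one kernel-verified Lean document; each statement's English description precedes it below -/
import Mathlib

section
/- For all β, γ ∈ Δ₊^{nc,1} ∪ Δ₊^{nc,2}, the sum β + γ is not a root of Δ. -/
open scoped RealInnerProductSpace

/-- A finite reduced crystallographic root system spanning a finite-dimensional
real inner product space `V`. -/
structure IsRootSystem {V : Type*} [NormedAddCommGroup V] [InnerProductSpace ℝ V]
    [FiniteDimensional ℝ V] (Δ : Set V) : Prop where
  finite : Δ.Finite
  zero_not_mem : (0 : V) ∉ Δ
  span_eq_top : Submodule.span ℝ Δ = ⊤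
  reflection_mem : ∀ α ∈ Δ, ∀ β ∈ Δ, β - (2 * ⟪β, α⟫ / ⟪α, α⟫) • α ∈ Δ
  crystallographic : ∀ α ∈ Δ, ∀ β ∈ Δ, ∃ n : ℤ, 2 * ⟪β, α⟫ / ⟪α, α⟫ = (n : ℝ)
  reduced : ∀ α ∈ Δ, ∀ c : ℝ, c • α ∈ Δ → c = 1 ∨ c = -1

/-- A partition `Δ = Δc ⊔ Δnc` into compact and noncompact roots, closed under
negation, and such that sums of roots obey the parity rules. -/
structure IsCompactDecomp {V : Type*} [NormedAddCommGroup V] [InnerProductSpace ℝ V]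
    [FiniteDimensional ℝ V] (Δ Δc Δnc : Set V) : Prop where
  union_eq : Δc ∪ Δnc = Δ
  inter_eq : Δc ∩ Δnc = ∅
  neg_c : ∀ α ∈ Δc, -α ∈ Δc
  neg_nc : ∀ α ∈ Δnc, -α ∈ Δnc
  add_cc : ∀ α ∈ Δc, ∀ β ∈ Δc, α + β ∈ Δ → α + β ∈ Δc
  add_ncnc : ∀ α ∈ Δnc, ∀ β ∈ Δnc, α + β ∈ Δ → α + β ∈ Δc
  add_cnc : ∀ α ∈ Δc, ∀ β ∈ Δnc, α + β ∈ Δ → α + β ∈ Δnc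

/-- A choice of positive roots `Δp` in the root system `Δ`. -/
structure IsPositiveSystem {V : Type*} [NormedAddCommGroup V] [InnerProductSpace ℝ V]
    [FiniteDimensional ℝ V] (Δ Δp : Set V) : Prop where
  subset : Δp ⊆ Δ
  mem_or_neg_mem : ∀ α ∈ Δ, α ∈ Δp ∨ -α ∈ Δp
  neg_not_mem : ∀ α ∈ Δp, -α ∉ Δp
  add_mem : ∀ α ∈ Δp, ∀ β ∈ Δp, α + β ∈ Δ → α + β ∈ Δp

/-- `Δ` is irreducible: it is not the union of two nonempty mutually orthogonal subsets. -/
def RootIrreducible {V : Type*} [NormedAddCommGroup V] [InnerProductSpace ℝ V]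
    [FiniteDimensional ℝ V] (Δ : Set V) : Prop :=
  ¬ ∃ Δ₁ Δ₂ : Set V, Δ₁.Nonempty ∧ Δ₂.Nonempty ∧ Δ₁ ∪ Δ₂ = Δ ∧
      ∀ α ∈ Δ₁, ∀ β ∈ Δ₂, ⟪α, β⟫ = 0

namespace IsRootSystem

variable {V : Type*} [NormedAddCommGroup V] [InnerProductSpace ℝ V] [FiniteDimensional ℝ V]
  {Δ : Set V} {a b c : V}

theorem ne_zero (h : IsRootSystem Δ) (ha : a ∈ Δ) : a ≠ 0 :=
  fun h0 => h.zero_not_mem (h0 ▸ ha)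

theorem inner_self_pos (h : IsRootSystem Δ) (ha : a ∈ Δ) : 0 < ⟪a, a⟫ :=
  real_inner_self_pos.2 (h.ne_zero ha)

theorem neg_mem (h : IsRootSystem Δ) (ha : a ∈ Δ) : -a ∈ Δ := by
  have hr := h.reflection_mem a ha a ha
  rw [mul_div_assoc, div_self (h.inner_self_pos ha).ne', mul_one, two_smul] at hr
  simpa using hr

/-- If two roots form an obtuse angle, either their sum is a root or the inner product is at most
minus the squared length of the second one. -/
theorem add_mem_or_inner_le (h : IsRootSystem Δ) (ha : a ∈ Δ) (hb : b ∈ Δ) (hab : ⟪a, b⟫ < 0) :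
    a + b ∈ Δ ∨ ⟪a, b⟫ ≤ -⟪b, b⟫ := by
  obtain ⟨n, hn⟩ := h.crystallographic b hb a ha
  have hpos := h.inner_self_pos hb
  have hr := h.reflection_mem b hb a ha
  rw [hn] at hr
  rw [div_eq_iff hpos.ne'] at hn
  have hn0 : n < 0 := by
    by_contra! hn0
    have : (0 : ℝ) ≤ n := by exact_mod_cast hn0
    nlinarith
  obtain rfl | hn2 : n = -1 ∨ n ≤ -2 := by omega
  · left
    simpa using hr
  · right
    have : (n : ℝ) ≤ -2 := by exact_mod_cast hn2
    nlinarith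

theorem add_mem_of_inner_neg (h : IsRootSystem Δ) (ha : a ∈ Δ) (hb : b ∈ Δ) (hab : ⟪a, b⟫ < 0)
    (hne : a + b ≠ 0) : a + b ∈ Δ := by
  by_contra hmem
  have h1 := (h.add_mem_or_inner_le ha hb hab).resolve_left hmem
  have h2 := (h.add_mem_or_inner_le hb ha (by rwa [real_inner_comm])).resolve_left
    (by rwa [add_comm])
  have h3 := real_inner_self_pos.2 hne
  rw [real_inner_add_add_self] at h3
  rw [real_inner_comm] at h2
  linarith

/-- A root-theoretic form of the Jacobi identity. -/
theorem add_mem_or_add_mem (h : IsRootSystem Δ) (ha : a ∈ Δ) (hb : b ∈ Δ) (hc : c ∈ Δ)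
    (hab : a + b ∈ Δ) (habc : a + b + c ∈ Δ) (hac0 : a + c ≠ 0) (hbc0 : b + c ≠ 0) :
    a + c ∈ Δ ∨ b + c ∈ Δ := by
  by_contra! hcon
  obtain ⟨hac, hbc⟩ := hcon
  have hd := h.neg_mem habc
  have had : a + -(a + b + c) = -(b + c) := by abel
  have hbd : b + -(a + b + c) = -(a + c) := by abel
  have i1 : 0 ≤ ⟪a, c⟫ := by
    by_contra! hlt
    exact hac (h.add_mem_of_inner_neg ha hc hlt hac0)
  have i2 : 0 ≤ ⟪b, c⟫ := by
    by_contra! hlt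
    exact hbc (h.add_mem_of_inner_neg hb hc hlt hbc0)
  have i3 : 0 ≤ ⟪a, -(a + b + c)⟫ := by
    by_contra! hlt
    have hm := h.add_mem_of_inner_neg ha hd hlt (by rw [had]; exact neg_ne_zero.2 hbc0)
    rw [had] at hm
    exact hbc (by simpa using h.neg_mem hm)
  have i4 : 0 ≤ ⟪b, -(a + b + c)⟫ := by
    by_contra! hlt
    have hm := h.add_mem_of_inner_neg hb hd hlt (by rw [hbd]; exact neg_ne_zero.2 hac0)
    rw [hbd] at hm
    exact hac (by simpa using h.neg_mem hm)
  have hpos := h.inner_self_pos hab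
  simp only [inner_neg_right, inner_add_right, inner_add_left] at i3 i4 hpos
  linarith

end IsRootSystem

theorem IsPositiveSystem.add_ne_zero {V : Type*} [NormedAddCommGroup V] [InnerProductSpace ℝ V]
    [FiniteDimensional ℝ V] {Δ Δp : Set V} (h : IsPositiveSystem Δ Δp) {a b : V}
    (ha : a ∈ Δp) (hb : b ∈ Δp) : a + b ≠ 0 :=
  fun h0 => h.neg_not_mem a ha (neg_eq_of_add_eq_zero_right h0 ▸ hb)

/-- Property I: no sum of two roots of `Δ₊^{nc,1} ∪ Δ₊^{nc,2}` is a root. -/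
theorem nc12_add_nc12_not_root {V : Type*} [NormedAddCommGroup V]
    [InnerProductSpace ℝ V] [FiniteDimensional ℝ V] (Δ Δc Δnc Δp : Set V)
    (hRS : IsRootSystem Δ) (hCD : IsCompactDecomp Δ Δc Δnc) (hPS : IsPositiveSystem Δ Δp)
    (lam : V)
    (h1 : ∀ α ∈ Δc ∩ Δp, 0 ≤ ⟪lam, α⟫)
    (h2 : ∀ β ∈ Δnc ∩ Δp, ⟪lam, β⟫ ≤ 0)
    (nc1 nc2 : Set V)
    (hnc1 : nc1 = {β | β ∈ Δnc ∩ Δp ∧ ⟪lam, β⟫ < 0})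
    (hnc2 : nc2 = {β | β ∈ Δnc ∩ Δp ∧ ⟪lam, β⟫ = 0 ∧
      ∃ α ∈ Δc ∩ Δp, ∃ β' ∈ nc1, β = α + β'}) :
    ∀ β ∈ nc1 ∪ nc2, ∀ γ ∈ nc1 ∪ nc2, β + γ ∉ Δ := by
  have key : ∀ β ∈ nc1, ∀ γ ∈ Δnc ∩ Δp, β + γ ∉ Δ := by
    rintro β hβ γ ⟨hγn, hγp⟩ hmem
    rw [hnc1] at hβ
    obtain ⟨⟨hβn, hβp⟩, hβ⟩ := hβ
    have hpos := h1 _ ⟨hCD.add_ncnc β hβn γ hγn hmem, hPS.add_mem β hβp γ hγp hmem⟩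
    rw [inner_add_right] at hpos
    linarith [h2 γ ⟨hγn, hγp⟩]
  have sub1 : ∀ β ∈ nc1, β ∈ Δnc ∩ Δp := by
    rw [hnc1]
    exact fun β hβ => hβ.1
  have sub2 : ∀ β ∈ nc2, β ∈ Δnc ∩ Δp := by
    rw [hnc2]
    exact fun β hβ => hβ.1
  rintro β (hβ | hβ) γ hγ hmem
  · exact key β hβ γ (hγ.elim (sub1 γ) (sub2 γ)) hmem
  obtain hγ | hγ := hγ
  · exact key γ hγ β (sub2 β hβ) (by rwa [add_comm])
  rw [hnc2] at hβ hγ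
  obtain ⟨⟨hβn, hβp⟩, hβ0, α, ⟨hαc, hαp⟩, β', hβ', rfl⟩ := hβ
  obtain ⟨⟨hγn, hγp⟩, hγ0, -⟩ := hγ
  obtain ⟨hβ'n, hβ'p⟩ := sub1 β' hβ'
  rcases hRS.add_mem_or_add_mem (hPS.subset hαp) (hPS.subset hβ'p) (hPS.subset hγp)
    (hPS.subset hβp) hmem (hPS.add_ne_zero hαp hγp) (hPS.add_ne_zero hβ'p hγp) with hαγ | hβγ
  · have hle := h2 _ ⟨hCD.add_cnc α hαc γ hγn hαγ, hPS.add_mem α hαp γ hγp hαγ⟩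
    rw [hnc1] at hβ'
    have hlt := hβ'.2
    rw [inner_add_right] at hle hβ0
    linarith
  · exact key β' hβ' γ ⟨hγn, hγp⟩ hβγ
end

section
/- For every β' ∈ Δ₊^{nc,3} and every β ∈ Δ₊^{nc,1} ∪ Δ₊^{nc,2}, neither β' + β nor β' − β is a root of Δ. -/
open scoped RealInnerProductSpace

namespace IsRootSystem

variable {V : Type*} [NormedAddCommGroup V] [InnerProductSpace ℝ V] [FiniteDimensional ℝ V]
  {Δ : Set V}

theorem add_mem_of_inner_neg_of_neg_inner_lt (hΔ : IsRootSystem Δ) {α β : V} (hα : α ∈ Δ)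
    (hβ : β ∈ Δ) (hneg : ⟪β, α⟫ < 0) (hlt : -⟪β, α⟫ < ⟪α, α⟫) : β + α ∈ Δ := by
  have hpos : 0 < ⟪α, α⟫ := by linarith
  obtain ⟨n, hn⟩ := hΔ.crystallographic α hα β hβ
  have hn0 : (n : ℝ) < 0 := by
    rw [← hn]; exact div_neg_of_neg_of_pos (by linarith) hpos
  have hn2 : (-2 : ℝ) < n := by
    rw [← hn, lt_div_iff₀ hpos]; linarith
  have hn1 : n = -1 := by
    have : n < 0 := by exact_mod_cast hn0
    have : -2 < n := by exact_mod_cast hn2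
    omega
  have hr := hΔ.reflection_mem α hα β hβ
  rw [hn, hn1] at hr
  simpa using hr

/-- Two roots at an obtuse angle add up to a root unless they are opposite. -/
theorem add_mem_or_eq_zero_of_inner_neg (hΔ : IsRootSystem Δ) {α β : V} (hα : α ∈ Δ)
    (hβ : β ∈ Δ) (hneg : ⟪α, β⟫ < 0) : α + β ∈ Δ ∨ α + β = 0 := by
  have hcomm : ⟪β, α⟫ = ⟪α, β⟫ := real_inner_comm _ _
  by_cases h₁ : -⟪α, β⟫ < ⟪β, β⟫
  · exact .inl (hΔ.add_mem_of_inner_neg_of_neg_inner_lt hβ hα hneg h₁)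
  by_cases h₂ : -⟪β, α⟫ < ⟪α, α⟫
  · rw [add_comm]
    exact .inl (hΔ.add_mem_of_inner_neg_of_neg_inner_lt hα hβ (hcomm ▸ hneg) h₂)
  right
  rw [← real_inner_self_nonpos]
  simp only [inner_add_left, inner_add_right]
  linarith

theorem neg_mem_s8 (hΔ : IsRootSystem Δ) {α : V} (hα : α ∈ Δ) : -α ∈ Δ := by
  have hne : ⟪α, α⟫ ≠ 0 := inner_self_ne_zero.2 fun h => hΔ.zero_not_mem (h ▸ hα)
  have hr := hΔ.reflection_mem α hα α hα
  rw [mul_div_assoc, div_self hne] at hr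
  convert hr using 1
  module

theorem add_mem_or_of_add_add_mem (hΔ : IsRootSystem Δ) {α β γ : V} (hα : α ∈ Δ) (hβ : β ∈ Δ)
    (hγ : γ ∈ Δ) (hβγ : β + γ ∈ Δ) (hsum : α + (β + γ) ∈ Δ) :
    (α + β ∈ Δ ∨ α + β = 0) ∨ (α + γ ∈ Δ ∨ α + γ = 0) := by
  by_contra! h
  obtain ⟨h₁, h₂⟩ := h
  have hαβ : 0 ≤ ⟪α, β⟫ := by
    by_contra! hlt
    exact (hΔ.add_mem_or_eq_zero_of_inner_neg hα hβ hlt).elim h₁.1 h₁.2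
  have hαγ : 0 ≤ ⟪α, γ⟫ := by
    by_contra! hlt
    exact (hΔ.add_mem_or_eq_zero_of_inner_neg hα hγ hlt).elim h₂.1 h₂.2
  have hsβ : ⟪α + (β + γ), β⟫ ≤ 0 := by
    by_contra! hlt
    have := hΔ.add_mem_or_eq_zero_of_inner_neg hsum (hΔ.neg_mem_s8 hβ)
      (by rwa [inner_neg_right, neg_lt_zero])
    rw [show α + (β + γ) + -β = α + γ by abel] at this
    exact this.elim h₂.1 h₂.2
  have hsγ : ⟪α + (β + γ), γ⟫ ≤ 0 := by
    by_contra! hlt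
    have := hΔ.add_mem_or_eq_zero_of_inner_neg hsum (hΔ.neg_mem_s8 hγ)
      (by rwa [inner_neg_right, neg_lt_zero])
    rw [show α + (β + γ) + -γ = α + β by abel] at this
    exact this.elim h₁.1 h₁.2
  have hzero : β + γ = 0 := by
    rw [← real_inner_self_nonpos]
    simp only [inner_add_left, inner_add_right] at *
    linarith
  exact hΔ.zero_not_mem (hzero ▸ hβγ)

end IsRootSystem

/-- Property II: for `β' ∈ Δ₊^{nc,3}` and `β ∈ Δ₊^{nc,1} ∪ Δ₊^{nc,2}`, neither
`β' + β` nor `β' - β` is a root. -/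
theorem nc3_pm_nc12_not_root {V : Type*} [NormedAddCommGroup V]
    [InnerProductSpace ℝ V] [FiniteDimensional ℝ V] (Δ Δc Δnc Δp : Set V)
    (hRS : IsRootSystem Δ) (hCD : IsCompactDecomp Δ Δc Δnc) (hPS : IsPositiveSystem Δ Δp)
    (lam : V)
    (h1 : ∀ α ∈ Δc ∩ Δp, 0 ≤ ⟪lam, α⟫)
    (h2 : ∀ β ∈ Δnc ∩ Δp, ⟪lam, β⟫ ≤ 0)
    (nc1 nc2 nc3 : Set V)
    (hnc1 : nc1 = {β | β ∈ Δnc ∩ Δp ∧ ⟪lam, β⟫ < 0})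
    (hnc2 : nc2 = {β | β ∈ Δnc ∩ Δp ∧ ⟪lam, β⟫ = 0 ∧
      ∃ α ∈ Δc ∩ Δp, ∃ β' ∈ nc1, β = α + β'})
    (hnc3 : nc3 = (Δnc ∩ Δp) \ (nc1 ∪ nc2)) :
    ∀ β' ∈ nc3, ∀ β ∈ nc1 ∪ nc2, β' + β ∉ Δ ∧ β' - β ∉ Δ := by
  have cΔ : ∀ {α}, α ∈ Δc → α ∈ Δ := fun h => hCD.union_eq ▸ Or.inl h
  have ncΔ : ∀ {α}, α ∈ Δnc → α ∈ Δ := fun h => hCD.union_eq ▸ Or.inr h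
  have nc_inner_neg : ∀ {μ}, μ ∈ Δnc → ⟪lam, μ⟫ < 0 → μ ∈ nc1 := by
    intro μ hμ hlt
    rw [hnc1]
    refine ⟨⟨hμ, (hPS.mem_or_neg_mem μ (ncΔ hμ)).resolve_right fun hn => ?_⟩, hlt⟩
    have := h2 (-μ) ⟨hCD.neg_nc μ hμ, hn⟩
    rw [inner_neg_right] at this
    linarith
  have c_inner_pos : ∀ {μ}, μ ∈ Δc → 0 < ⟪lam, μ⟫ → μ ∈ Δp := by
    intro μ hμ hlt
    refine (hPS.mem_or_neg_mem μ (cΔ hμ)).resolve_right fun hn => ?_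
    have := h1 (-μ) ⟨hCD.neg_c μ hμ, hn⟩
    rw [inner_neg_right] at this
    linarith
  intro β' hβ'
  rw [hnc3] at hβ'
  obtain ⟨⟨hβ'n, hβ'p⟩, hβ'12⟩ := hβ'
  have hβ'0 : ⟪lam, β'⟫ = 0 := by
    refine le_antisymm (h2 β' ⟨hβ'n, hβ'p⟩) (not_lt.1 fun hlt => hβ'12 (.inl ?_))
    exact nc_inner_neg hβ'n hlt
  have hβ'ne : ∀ α ∈ Δc ∩ Δp, ∀ γ ∈ nc1, β' ≠ α + γ := by
    intro α hα γ hγ h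
    refine hβ'12 (.inr ?_)
    rw [hnc2]
    exact ⟨⟨hβ'n, hβ'p⟩, hβ'0, α, hα, γ, hγ, h⟩
  have key : ∀ γ ∈ nc1, β' + γ ∉ Δ ∧ β' - γ ∉ Δ := by
    intro γ hγ
    obtain ⟨⟨hγn, hγp⟩, hγ0⟩ := hnc1 ▸ hγ
    refine ⟨fun h => ?_, fun h => ?_⟩
    · have := h1 _ ⟨hCD.add_ncnc _ hβ'n _ hγn h, hPS.add_mem _ hβ'p _ hγp h⟩
      rw [inner_add_right] at this
      linarith
    · have hc : β' - γ ∈ Δc := by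
        rw [sub_eq_add_neg] at h ⊢
        exact hCD.add_ncnc _ hβ'n _ (hCD.neg_nc _ hγn) h
      refine hβ'ne _ ⟨hc, c_inner_pos hc ?_⟩ γ hγ (sub_add_cancel _ _).symm
      rw [inner_sub_right]
      linarith
  rintro β (hβ | hβ)
  · exact key β hβ
  rw [hnc2] at hβ
  obtain ⟨⟨hβn, -⟩, hβ0, α, ⟨hαc, hαp⟩, γ, hγ, rfl⟩ := hβ
  obtain ⟨⟨hγn, hγp⟩, hγ0⟩ := hnc1 ▸ hγ
  obtain ⟨hadd, hsub⟩ := key γ hγ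
  have hα0 : 0 < ⟪lam, α⟫ := by
    rw [inner_add_right] at hβ0
    linarith
  refine ⟨fun h => ?_, fun h => ?_⟩
  · rcases hRS.add_mem_or_of_add_add_mem (ncΔ hβ'n) (cΔ hαc) (ncΔ hγn) (ncΔ hβn) h with
      (h' | h') | (h' | h')
    · have hn : β' + α ∈ Δnc := by
        rw [add_comm] at h' ⊢
        exact hCD.add_cnc _ hαc _ hβ'n h'
      have := h2 _ ⟨hn, hPS.add_mem _ hβ'p _ hαp h'⟩
      rw [inner_add_right] at this
      linarith
    · have := congrArg (inner ℝ lam) h'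
      rw [inner_add_right, inner_zero_right] at this
      linarith
    · exact hadd h'
    · have := congrArg (inner ℝ lam) h'
      rw [inner_add_right, inner_zero_right] at this
      linarith
  · rw [sub_eq_add_neg, neg_add] at h
    have hneg : -α + -γ ∈ Δ := by
      rw [← neg_add]
      exact hRS.neg_mem_s8 (ncΔ hβn)
    rcases hRS.add_mem_or_of_add_add_mem (ncΔ hβ'n) (hRS.neg_mem_s8 (cΔ hαc))
      (hRS.neg_mem_s8 (ncΔ hγn)) hneg h with (h' | h') | (h' | h')
    · have hn : β' + -α ∈ Δnc := by
        rw [add_comm] at h' ⊢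
        exact hCD.add_cnc _ (hCD.neg_c _ hαc) _ hβ'n h'
      refine hβ'ne α ⟨hαc, hαp⟩ _ (nc_inner_neg hn ?_) (by abel)
      rw [inner_add_right, inner_neg_right]
      linarith
    · have := congrArg (inner ℝ lam) h'
      rw [inner_add_right, inner_neg_right, inner_zero_right] at this
      linarith
    · exact hsub (by rwa [sub_eq_add_neg])
    · have := congrArg (inner ℝ lam) h'
      rw [inner_add_right, inner_neg_right, inner_zero_right] at this
      linarith
end
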